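/- arXiv:1408.4153 — 2 statements merged into one kernel-verified Lean document; each statement's English description precedes it below -/
import Mathlib

section
/- Let G be a finite graph (multiple edges allowed) with vertex set V, edge set E, all vertex degrees positive, and maximum degree d_max, with the convention d_max ≥ 2. Take C(v) = {0,1} for every vertex v, so p_m is the number of matchings of G with exactly m edges, and let X be the random variable with Prob(X = m) = p_m/P(1), where P(z) = Σ_m p_m z^m is the matching polynomial. If |E| ≥ 2.2×10^8·d_max^4, then sup_m |Prob(X = m) − (2π·Var(X))^{−1/2}·exp(−(m − E[X])²/(2·Var(X)))| ≤ 200·d_max^4/(π·|E|), where the supremum is over all integers m. -/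
open Finset Real

/-- The number of edges of the subgraph `M` incident to the vertex `v`
(the degree `d_M(v)`); for `M = univ` this is the degree `d_v` of `v` in `G`. -/
def degIn {V E : Type*} [Fintype E] [DecidableEq V]
    (v1 v2 : E → V) (M : Finset E) (v : V) : ℕ :=
  (M.filter (fun e => v1 e = v ∨ v2 e = v)).card

/-- `p_m`, the number of matchings of `G` with exactly `m` edges. -/
def matchCount {V E : Type*} [Fintype V] [Fintype E] [DecidableEq V] [DecidableEq E]
    (v1 v2 : E → V) (m : ℕ) : ℕ :=
  (Finset.univ.filter
    (fun M : Finset E => (∀ v, degIn v1 v2 M v ≤ 1) ∧ M.card = m)).card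

/-- `P(1) = Σ_m p_m`, the total number of matchings of `G`. -/
noncomputable def mTotal {V E : Type*} [Fintype V] [Fintype E] [DecidableEq V] [DecidableEq E]
    (v1 v2 : E → V) : ℝ :=
  ∑ m ∈ Finset.range (Fintype.card E + 1), (matchCount v1 v2 m : ℝ)

/-- `E[X] = Σ_m m p_m / P(1)` for the random matching size `X`. -/
noncomputable def mEX {V E : Type*} [Fintype V] [Fintype E] [DecidableEq V] [DecidableEq E]
    (v1 v2 : E → V) : ℝ :=
  (∑ m ∈ Finset.range (Fintype.card E + 1), (m : ℝ) * (matchCount v1 v2 m : ℝ)) /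
    mTotal v1 v2

/-- `Var(X) = Σ_m m² p_m / P(1) − E[X]²` for the random matching size `X`. -/
noncomputable def mVar {V E : Type*} [Fintype V] [Fintype E] [DecidableEq V] [DecidableEq E]
    (v1 v2 : E → V) : ℝ :=
  (∑ m ∈ Finset.range (Fintype.card E + 1), (m : ℝ) ^ 2 * (matchCount v1 v2 m : ℝ)) /
    mTotal v1 v2 - (mEX v1 v2) ^ 2

/-- `Prob(X = m)` for an integer `m`. -/
noncomputable def mProb {V E : Type*} [Fintype V] [Fintype E] [DecidableEq V] [DecidableEq E]
    (v1 v2 : E → V) (m : ℤ) : ℝ :=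
  if 0 ≤ m then (matchCount v1 v2 m.toNat : ℝ) / mTotal v1 v2 else 0


theorem aux_cos_taylor (y : ℝ) : |Real.cos y - 1 + y ^ 2 / 2| ≤ |y| ^ 4 / 24 := by
  have h1 := abs_sub_sin_le (y / 2)
  have h2 := Real.abs_sin_le_abs (x := y / 2)
  have e : Real.cos y - 1 + y ^ 2 / 2 = 2 * ((y / 2 - Real.sin (y / 2)) * (y / 2 + Real.sin (y / 2))) := by
    have := Real.cos_sq_add_sin_sq (y / 2)
    have h3 := Real.cos_two_mul (y / 2)
    rw [show 2 * (y / 2) = y by ring] at h3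
    rw [h3]; linear_combination 2 * this
  rw [e, abs_mul, abs_mul, abs_two]
  have h4 : |y / 2 + Real.sin (y / 2)| ≤ |y / 2| + |y / 2| := (abs_add_le _ _).trans (by linarith)
  have h5 : |y / 2| = |y| / 2 := by rw [abs_div, abs_two]
  rw [h5] at h1 h4
  calc _ ≤ 2 * (((|y| / 2) ^ 3 / 6) * (|y| / 2 + |y| / 2)) := by gcongr
    _ = _ := by ring

theorem aux_exp_taylor (y : ℝ) (hy : |y| ≤ π) :
    ‖Complex.exp (y * Complex.I) - (1 + y * Complex.I - y ^ 2 / 2)‖ ≤ |y| ^ 3 / 3 := by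
  refine (Complex.norm_le_abs_re_add_abs_im _).trans ?_
  have hre : (Complex.exp (y * Complex.I) - (1 + y * Complex.I - y ^ 2 / 2)).re
      = Real.cos y - 1 + y ^ 2 / 2 := by
    rw [Complex.exp_mul_I, ← Complex.ofReal_cos, ← Complex.ofReal_sin]
    have : ((y : ℂ) ^ 2 / 2) = ((y ^ 2 / 2 : ℝ) : ℂ) := by push_cast; rfl
    rw [this]
    simp only [Complex.sub_re, Complex.add_re, Complex.mul_re, Complex.ofReal_re, Complex.ofReal_im,
      Complex.I_re, Complex.I_im, Complex.one_re]
    ring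
  have him : (Complex.exp (y * Complex.I) - (1 + y * Complex.I - y ^ 2 / 2)).im
      = -(y - Real.sin y) := by
    rw [Complex.exp_mul_I, ← Complex.ofReal_cos, ← Complex.ofReal_sin]
    have : ((y : ℂ) ^ 2 / 2) = ((y ^ 2 / 2 : ℝ) : ℂ) := by push_cast; rfl
    rw [this]
    simp only [Complex.sub_im, Complex.add_im, Complex.mul_im, Complex.ofReal_re, Complex.ofReal_im,
      Complex.I_re, Complex.I_im, Complex.one_im]
    ring
  rw [hre, him, abs_neg]
  have h1 := abs_sub_sin_le y
  have h2 := aux_cos_taylor y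
  have h3 : |y| ^ 4 ≤ 4 * |y| ^ 3 := by
    have : |y| ≤ 4 := hy.trans Real.pi_le_four
    nlinarith [pow_nonneg (abs_nonneg y) 3]
  linarith

/-- centered characteristic function of a Bernoulli variable -/
noncomputable def psi (q t : ℝ) : ℂ :=
  (1 - q) * Complex.exp ((-(t * q) : ℝ) * Complex.I) + q * Complex.exp ((t * (1 - q) : ℝ) * Complex.I)

theorem psi_eq (q t : ℝ) :
    psi q t = Complex.exp ((-(t * q) : ℝ) * Complex.I) * (1 - q + q * Complex.exp (t * Complex.I)) := by
  unfold psi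
  have : Complex.exp ((t * (1 - q) : ℝ) * Complex.I)
      = Complex.exp ((-(t * q) : ℝ) * Complex.I) * Complex.exp (t * Complex.I) := by
    rw [← Complex.exp_add]; congr 1; push_cast; ring
  rw [this]; ring

theorem psi_taylor (q t : ℝ) (h0 : 0 ≤ q) (h1 : q ≤ 1) (ht : |t| ≤ π) :
    ‖psi q t - (1 - q * (1 - q) * t ^ 2 / 2)‖ ≤ q * (1 - q) * |t| ^ 3 / 3 := by
  have hq : |-(t * q)| = |t| * q := by rw [abs_neg, abs_mul, abs_of_nonneg h0]
  have hq' : |t * (1 - q)| = |t| * (1 - q) := by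
    rw [abs_mul, abs_of_nonneg (show 0 ≤ 1 - q by linarith)]
  have a1 := aux_exp_taylor (-(t * q)) (by rw [hq]; nlinarith [abs_nonneg t])
  have a2 := aux_exp_taylor (t * (1 - q)) (by rw [hq']; nlinarith [abs_nonneg t])
  rw [hq] at a1
  rw [hq'] at a2
  have e : psi q t - (1 - q * (1 - q) * t ^ 2 / 2) =
      ((1 - q : ℝ) : ℂ) * (Complex.exp ((-(t * q) : ℝ) * Complex.I) -
        (1 + (-(t * q) : ℝ) * Complex.I - (-(t * q) : ℝ) ^ 2 / 2)) +
      ((q : ℝ) : ℂ) * (Complex.exp ((t * (1 - q) : ℝ) * Complex.I) -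
        (1 + (t * (1 - q) : ℝ) * Complex.I - (t * (1 - q) : ℝ) ^ 2 / 2)) := by
    unfold psi; push_cast; ring
  rw [e]
  refine (norm_add_le _ _).trans ?_
  rw [norm_mul, norm_mul, Complex.norm_real, Complex.norm_real, Real.norm_eq_abs, Real.norm_eq_abs,
    abs_of_nonneg h0, abs_of_nonneg (show 0 ≤ 1 - q by linarith)]
  have hq1 : 0 ≤ 1 - q := by linarith
  calc _ ≤ (1 - q) * ((|t| * q) ^ 3 / 3) + q * ((|t| * (1 - q)) ^ 3 / 3) := by gcongr
    _ = (q * (1 - q) * |t| ^ 3 / 3) * (q ^ 2 + (1 - q) ^ 2) := by ring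
    _ ≤ (q * (1 - q) * |t| ^ 3 / 3) * 1 := by
      gcongr; nlinarith
    _ = _ := by ring

theorem exp_quad (s : ℝ) (hs : 0 ≤ s) : |Real.exp (-s) - (1 - s)| ≤ s ^ 2 / 2 := by
  have h1 := Real.add_one_le_exp (-s)
  have h2 : Real.exp (-s) ≤ 1 - s + s ^ 2 / 2 := by
    have h3 := Real.quadratic_le_exp_of_nonneg hs
    rw [Real.exp_neg, inv_le_comm₀ (Real.exp_pos s) (by nlinarith [sq_nonneg (s - 1)])]
    refine le_trans ?_ h3
    rw [inv_le_iff_one_le_mul₀ (by nlinarith [sq_nonneg (s - 1)])]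
    nlinarith [sq_nonneg (s ^ 2)]
  rw [abs_le]; constructor <;> nlinarith [sq_nonneg s]

theorem psi_sub_gauss (q t : ℝ) (h0 : 0 ≤ q) (h1 : q ≤ 1) (ht : |t| ≤ π) :
    ‖psi q t - (Real.exp (-(q * (1 - q) * t ^ 2 / 2)) : ℝ)‖ ≤ q * (1 - q) * |t| ^ 3 / 2 := by
  have a := psi_taylor q t h0 h1 ht
  have hv : 0 ≤ q * (1 - q) := mul_nonneg h0 (by linarith)
  have hv4 : q * (1 - q) ≤ 1 / 4 := by nlinarith [sq_nonneg (q - 1 / 2)]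
  have b := exp_quad (q * (1 - q) * t ^ 2 / 2) (by positivity)
  have e : psi q t - (Real.exp (-(q * (1 - q) * t ^ 2 / 2)) : ℝ) =
    (psi q t - (1 - q * (1 - q) * t ^ 2 / 2)) -
      ((Real.exp (-(q * (1 - q) * t ^ 2 / 2)) - (1 - q * (1 - q) * t ^ 2 / 2) : ℝ) : ℂ) := by
    push_cast; ring
  rw [e]
  refine (norm_sub_le _ _).trans ?_
  rw [Complex.norm_real, Real.norm_eq_abs]
  have c : (q * (1 - q) * t ^ 2 / 2) ^ 2 / 2 ≤ q * (1 - q) * |t| ^ 3 / 6 := by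
    rw [← sq_abs t]
    have h4 : |t| ≤ 4 := ht.trans Real.pi_le_four
    have h5 : q * (1 - q) * |t| ≤ 1 / 4 * 4 := by gcongr
    calc (q * (1 - q) * |t| ^ 2 / 2) ^ 2 / 2
        = (q * (1 - q) * |t| ^ 3 / 8) * (q * (1 - q) * |t|) := by ring
      _ ≤ (q * (1 - q) * |t| ^ 3 / 8) * (1 / 4 * 4) := by gcongr
      _ ≤ _ := by nlinarith [mul_nonneg hv (pow_nonneg (abs_nonneg t) 3)]
  linarith

theorem psi_norm (q t : ℝ) (h0 : 0 ≤ q) (h1 : q ≤ 1) (ht : |t| ≤ π) :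
    ‖psi q t‖ ≤ Real.exp (-(2 / π ^ 2 * (q * (1 - q)) * t ^ 2)) := by
  have hv : 0 ≤ q * (1 - q) := mul_nonneg h0 (by linarith)
  have hc := Real.cos_le_one_sub_mul_cos_sq ht
  rw [psi_eq, norm_mul, Complex.norm_exp_ofReal_mul_I, one_mul]
  apply abs_le_of_sq_le_sq' _ (Real.exp_pos _).le |>.2
  rw [← Complex.normSq_eq_norm_sq]
  have : Complex.normSq (1 - q + q * Complex.exp (t * Complex.I)) = 1 - 2 * (q * (1 - q)) * (1 - Real.cos t) := by
    rw [Complex.exp_mul_I, ← Complex.ofReal_cos, ← Complex.ofReal_sin, Complex.normSq_apply]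
    simp [-Complex.ofReal_cos, -Complex.ofReal_sin]
    have := Real.cos_sq_add_sin_sq t
    linear_combination q ^ 2 * this
  rw [this, ← Real.exp_nat_mul]
  refine le_trans ?_ (Real.add_one_le_exp _)
  push_cast
  nlinarith [mul_nonneg hv (sub_nonneg.2 hc)]

theorem prod_psi_sub {ι : Type*} (s : Finset ι) (q : ι → ℝ) (h0 : ∀ i, 0 ≤ q i) (h1 : ∀ i, q i ≤ 1)
    (t : ℝ) (ht : |t| ≤ π) :
    ‖∏ i ∈ s, psi (q i) t - (Real.exp (-((∑ i ∈ s, q i * (1 - q i)) * t ^ 2 / 2)) : ℝ)‖ ≤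
      (∑ i ∈ s, q i * (1 - q i)) * |t| ^ 3 *
        Real.exp (-(2 / π ^ 2 * (∑ i ∈ s, q i * (1 - q i)) * t ^ 2)) := by
  classical
  induction s using Finset.induction_on with
  | empty => simp
  | insert j s hj ih =>
    rw [Finset.prod_insert hj, Finset.sum_insert hj]
    set S := ∑ i ∈ s, q i * (1 - q i) with hS
    set v := q j * (1 - q j) with hv
    have hvn : ∀ i, 0 ≤ q i * (1 - q i) := fun i => mul_nonneg (h0 i) (by linarith [h1 i])
    have hv0 : 0 ≤ v := hvn j
    have hS0 : 0 ≤ S := Finset.sum_nonneg fun i _ => hvn i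
    have hv4 : v ≤ 1 / 4 := by rw [hv]; nlinarith [sq_nonneg (q j - 1 / 2)]
    set Q := ∏ i ∈ s, psi (q i) t
    have hpi := Real.pi_pos
    have hexp : Real.exp (-((v + S) * t ^ 2 / 2)) = Real.exp (-(v * t ^ 2 / 2)) * Real.exp (-(S * t ^ 2 / 2)) := by
      rw [← Real.exp_add]; congr 1; ring
    have e : psi (q j) t * Q - (Real.exp (-((v + S) * t ^ 2 / 2)) : ℝ) =
        psi (q j) t * (Q - (Real.exp (-(S * t ^ 2 / 2)) : ℝ)) +
        (psi (q j) t - (Real.exp (-(v * t ^ 2 / 2)) : ℝ)) * (Real.exp (-(S * t ^ 2 / 2)) : ℝ) := by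
      rw [hexp]; push_cast; ring
    rw [e]
    refine (norm_add_le _ _).trans ?_
    rw [norm_mul, norm_mul, Complex.norm_real, Real.norm_eq_abs, abs_of_pos (Real.exp_pos _)]
    have b1 := psi_norm (q j) t (h0 j) (h1 j) ht
    have b2 := psi_sub_gauss (q j) t (h0 j) (h1 j) ht
    rw [← hv] at b1 b2
    have ht2 : t ^ 2 ≤ π ^ 2 := by rw [← sq_abs t]; gcongr
    have b3 : Real.exp (-(S * t ^ 2 / 2)) ≤ 2 * Real.exp (-(2 / π ^ 2 * (v + S) * t ^ 2)) := by
      have : (2 : ℝ) ≥ Real.exp (1 / 2) := by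
        have h := Real.exp_one_lt_d9
        have h2 : Real.exp (1 / 2) ^ 2 = Real.exp 1 := by rw [← Real.exp_nat_mul]; norm_num
        nlinarith [Real.exp_pos (1 / 2)]
      refine le_trans ?_ (mul_le_mul_of_nonneg_right this (Real.exp_pos _).le)
      rw [← Real.exp_add, Real.exp_le_exp]
      have c1 : 2 / π ^ 2 * v * t ^ 2 ≤ 1 / 2 := by
        calc 2 / π ^ 2 * v * t ^ 2 ≤ 2 / π ^ 2 * (1 / 4) * π ^ 2 := by gcongr
          _ = 1 / 2 := by field_simp; norm_num
      have c2 : 2 / π ^ 2 * S * t ^ 2 ≤ S * t ^ 2 / 2 := by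
        have : 2 / π ^ 2 ≤ 1 / 2 := by
          rw [div_le_div_iff₀ (by positivity) (by norm_num)]
          nlinarith [Real.pi_gt_three]
        calc 2 / π ^ 2 * S * t ^ 2 ≤ 1 / 2 * S * t ^ 2 := by gcongr
          _ = _ := by ring
      linarith
    have hexp2 : Real.exp (-(2 / π ^ 2 * v * t ^ 2)) * Real.exp (-(2 / π ^ 2 * S * t ^ 2))
        = Real.exp (-(2 / π ^ 2 * (v + S) * t ^ 2)) := by
      rw [← Real.exp_add]; congr 1; ring
    calc _ ≤ Real.exp (-(2 / π ^ 2 * v * t ^ 2)) * (S * |t| ^ 3 * Real.exp (-(2 / π ^ 2 * S * t ^ 2)))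
          + (v * |t| ^ 3 / 2) * (2 * Real.exp (-(2 / π ^ 2 * (v + S) * t ^ 2))) := by gcongr
      _ = _ := by rw [← hexp2]; ring

theorem integral_cube_gauss (b : ℝ) (hb : 0 < b) :
    ∫ t : ℝ, |t| ^ 3 * Real.exp (-(b * t ^ 2)) = 1 / b ^ 2 := by
  have h := integral_rpow_mul_exp_neg_mul_rpow (p := 2) (q := 3) (b := b) (by norm_num) (by norm_num) hb
  have h2 := integral_comp_abs (f := fun t : ℝ => t ^ 3 * Real.exp (-(b * t ^ 2)))
  simp only [sq_abs] at h2
  rw [h2]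
  have e : ∫ x in Set.Ioi (0 : ℝ), x ^ 3 * Real.exp (-(b * x ^ 2)) =
      ∫ x in Set.Ioi (0 : ℝ), x ^ (3 : ℝ) * Real.exp (-b * x ^ (2 : ℝ)) := by
    congr 1; ext x
    norm_cast
    rw [neg_mul]
  rw [e, h]
  have : Real.Gamma ((3 + 1) / 2) = 1 := by
    rw [show ((3 : ℝ) + 1) / 2 = (1 : ℕ) + 1 by norm_num, Real.Gamma_nat_eq_factorial]; simp
  rw [this, show (-(3 + 1) / 2 : ℝ) = -((2 : ℕ) : ℝ) by norm_num, Real.rpow_neg hb.le, Real.rpow_natCast]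
  field_simp

theorem integrable_cube_gauss (b : ℝ) (hb : 0 < b) :
    MeasureTheory.Integrable (fun t : ℝ => |t| ^ 3 * Real.exp (-(b * t ^ 2))) := by
  by_contra h
  have := integral_cube_gauss b hb
  rw [MeasureTheory.integral_undef h] at this
  have h2 : (0 : ℝ) < 1 / b ^ 2 := by positivity
  linarith

theorem gauss_inv (D x : ℝ) (hD : 0 < D) :
    (∫ t : ℝ, Complex.exp ((-(t * x) : ℝ) * Complex.I) * ((Real.exp (-(D * t ^ 2 / 2)) : ℝ) : ℂ)) =
      ((2 * π * ((Real.sqrt (2 * π * D))⁻¹ * Real.exp (-x ^ 2 / (2 * D))) : ℝ) : ℂ) := by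
  have h := fourierIntegral_gaussian (b := ((D / 2 : ℝ) : ℂ)) (by simpa using hD) ((-x : ℝ) : ℂ)
  have e : (∫ t : ℝ, Complex.exp ((-(t * x) : ℝ) * Complex.I) * ((Real.exp (-(D * t ^ 2 / 2)) : ℝ) : ℂ)) =
     ∫ t : ℝ, Complex.exp (Complex.I * ((-x : ℝ) : ℂ) * t) * Complex.exp (-((D / 2 : ℝ) : ℂ) * t ^ 2) := by
    congr 1; ext t
    push_cast
    congr 2 <;> ring
  rw [e, h]
  have hp := Real.pi_pos
  have e2 : ((π : ℂ) / ((D / 2 : ℝ) : ℂ)) ^ (1 / 2 : ℂ) = ((2 * π * (Real.sqrt (2 * π * D))⁻¹ : ℝ) : ℂ) := by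
    have : ((π : ℂ) / ((D / 2 : ℝ) : ℂ)) = ((π / (D / 2) : ℝ) : ℂ) := by push_cast; rfl
    rw [this, show (1 / 2 : ℂ) = ((1 / 2 : ℝ) : ℂ) by push_cast; rfl, ← Complex.ofReal_cpow (by positivity),
      ← Real.sqrt_eq_rpow]
    congr 1
    rw [eq_mul_inv_iff_mul_eq₀ (by positivity), ← Real.sqrt_mul (by positivity)]
    rw [show π / (D / 2) * (2 * π * D) = (2 * π) ^ 2 by field_simp]
    exact Real.sqrt_sq (by positivity)
  rw [e2, ← mul_assoc, Complex.ofReal_mul (2 * π * (Real.sqrt (2 * π * D))⁻¹), Complex.ofReal_exp]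
  congr 2
  push_cast
  field_simp
  ring

theorem gauss_integrable (D x : ℝ) (hD : 0 < D) :
    MeasureTheory.Integrable (fun t : ℝ => Complex.exp ((-(t * x) : ℝ) * Complex.I) * ((Real.exp (-(D * t ^ 2 / 2)) : ℝ) : ℂ)) := by
  by_contra h
  have := gauss_inv D x hD
  rw [MeasureTheory.integral_undef h] at this
  have hp := Real.pi_pos
  have h2 : 0 < (2 * π * ((Real.sqrt (2 * π * D))⁻¹ * Real.exp (-x ^ 2 / (2 * D))) : ℝ) := by positivity
  exact h2.ne (by exact_mod_cast this)

theorem lclt_integral {ι : Type*} [Fintype ι] (q : ι → ℝ) (h0 : ∀ i, 0 ≤ q i) (h1 : ∀ i, q i ≤ 1)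
    (D : ℝ) (hD : D = ∑ i, q i * (1 - q i)) (hD1 : 1 ≤ D) (x : ℝ) :
    ‖(∫ t in (-π)..π, Complex.exp ((-(t * x) : ℝ) * Complex.I) * ∏ i, psi (q i) t) -
      ((2 * π * ((Real.sqrt (2 * π * D))⁻¹ * Real.exp (-x ^ 2 / (2 * D))) : ℝ) : ℂ)‖ ≤
      π ^ 4 / (4 * D) := by
  have hp := Real.pi_pos
  have hD0 : 0 < D := by linarith
  rw [← gauss_inv D x (by linarith), intervalIntegral.integral_of_le (by linarith),
    ← MeasureTheory.integral_indicator measurableSet_Ioc]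
  have hcont : Continuous (fun t : ℝ => Complex.exp ((-(t * x) : ℝ) * Complex.I) * ∏ i, psi (q i) t) := by
    unfold psi; fun_prop
  rw [← MeasureTheory.integral_sub _ (gauss_integrable D x hD0)]
  swap
  · rw [MeasureTheory.integrable_indicator_iff measurableSet_Ioc]
    exact hcont.integrableOn_Ioc
  have hb : 0 < 2 / π ^ 2 * D := by positivity
  have hint : ∫ t : ℝ, D * (|t| ^ 3 * Real.exp (-(2 / π ^ 2 * D * t ^ 2))) = π ^ 4 / (4 * D) := by
    rw [MeasureTheory.integral_const_mul, integral_cube_gauss _ hb]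
    field_simp; norm_num
  rw [← hint]
  refine MeasureTheory.norm_integral_le_of_norm_le ((integrable_cube_gauss _ hb).const_mul D) ?_
  refine Filter.Eventually.of_forall fun t => ?_
  by_cases ht : t ∈ Set.Ioc (-π) π
  · rw [Set.indicator_of_mem ht, ← mul_sub, norm_mul, Complex.norm_exp_ofReal_mul_I, one_mul, hD, ← mul_assoc]
    exact prod_psi_sub _ q h0 h1 t (abs_le.2 ⟨ht.1.le, ht.2⟩)
  · rw [Set.indicator_of_notMem ht, zero_sub, norm_neg, norm_mul, Complex.norm_exp_ofReal_mul_I, one_mul,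
      Complex.norm_real, Real.norm_eq_abs, abs_of_pos (Real.exp_pos _)]
    have ht1 : 1 ≤ |t| := by
      by_contra hlt
      push Not at hlt
      have := abs_lt.1 hlt
      exact ht ⟨by linarith [Real.pi_gt_three], by linarith [Real.pi_gt_three]⟩
    have h3 : 1 ≤ |t| ^ 3 := one_le_pow₀ ht1
    have h4 : Real.exp (-(D * t ^ 2 / 2)) ≤ Real.exp (-(2 / π ^ 2 * D * t ^ 2)) := by
      rw [Real.exp_le_exp]
      have : 2 / π ^ 2 ≤ 1 / 2 := by
        rw [div_le_div_iff₀ (by positivity) (by norm_num)]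
        nlinarith [Real.pi_gt_three]
      have : 2 / π ^ 2 * D * t ^ 2 ≤ 1 / 2 * D * t ^ 2 := by gcongr
      linarith
    calc _ ≤ 1 * (1 * Real.exp (-(2 / π ^ 2 * D * t ^ 2))) := by linarith
      _ ≤ _ := by gcongr

theorem integral_exp_int (k : ℤ) :
    ∫ t in (-π)..π, Complex.exp ((t * k : ℝ) * Complex.I) = if k = 0 then ((2 * π : ℝ) : ℂ) else 0 := by
  split_ifs with hk
  · subst hk; simp; ring
  · have hc : (k : ℂ) * Complex.I ≠ 0 := mul_ne_zero (by exact_mod_cast hk) Complex.I_ne_zero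
    have := integral_exp_mul_complex (a := -π) (b := π) hc
    have e : ∀ t : ℝ, Complex.exp ((t * k : ℝ) * Complex.I) = Complex.exp ((k : ℂ) * Complex.I * t) := by
      intro t; congr 1; push_cast; ring
    simp only [e]
    rw [this, div_eq_zero_iff]; left
    rw [sub_eq_zero, Complex.exp_eq_exp_iff_exists_int]
    exact ⟨k, by push_cast; ring⟩

theorem lclt_bern {ι : Type*} [Fintype ι] (q : ι → ℝ) (h0 : ∀ i, 0 ≤ q i) (h1 : ∀ i, q i ≤ 1)
    (N : ℕ) (p : ℕ → ℝ)
    (hp : ∀ z : ℂ, ∑ k ∈ Finset.range N, (p k : ℂ) * z ^ k = ∏ i, (1 - q i + q i * z))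
    (hpN : ∀ k, N ≤ k → p k = 0)
    (D : ℝ) (hD : D = ∑ i, q i * (1 - q i)) (hD1 : 1 ≤ D) (μ : ℝ) (hμ : μ = ∑ i, q i) (m : ℤ) :
    |(if 0 ≤ m then p m.toNat else 0) -
      (Real.sqrt (2 * π * D))⁻¹ * Real.exp (-((m : ℝ) - μ) ^ 2 / (2 * D))| ≤ 25 / (π * D) := by
  have hpi := Real.pi_pos
  have key := lclt_integral q h0 h1 D hD hD1 (m - μ)
  have e : ∀ t : ℝ, Complex.exp ((-(t * (m - μ)) : ℝ) * Complex.I) * ∏ i, psi (q i) t =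
      ∑ k ∈ Finset.range N, (p k : ℂ) * Complex.exp ((t * ((k - m : ℤ)) : ℝ) * Complex.I) := by
    intro t
    simp only [psi_eq]
    rw [Finset.prod_mul_distrib, ← hp, ← Complex.exp_sum, ← mul_assoc, ← Complex.exp_add, Finset.mul_sum]
    refine Finset.sum_congr rfl fun k _ => ?_
    rw [← Complex.exp_nat_mul, mul_left_comm, ← Complex.exp_add]
    congr 2
    rw [hμ]
    push_cast
    rw [← Finset.sum_mul, Finset.sum_neg_distrib, ← Finset.mul_sum]
    ring
  have hI : (∫ t in (-π)..π, Complex.exp ((-(t * (m - μ)) : ℝ) * Complex.I) * ∏ i, psi (q i) t) =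
      ((2 * π * (if 0 ≤ m then p m.toNat else 0) : ℝ) : ℂ) := by
    simp only [e]
    rw [intervalIntegral.integral_finsetSum]
    swap
    · intro i _
      apply Continuous.intervalIntegrable
      fun_prop
    simp only [intervalIntegral.integral_const_mul, integral_exp_int]
    by_cases hm : 0 ≤ m
    · obtain ⟨n, rfl⟩ := Int.eq_ofNat_of_zero_le hm
      by_cases hn : n < N
      · rw [Finset.sum_eq_single n]
        · simp; ring
        · intro b _ hb
          rw [if_neg (by omega), mul_zero]
        · intro h; exact absurd (Finset.mem_range.2 hn) h
      · rw [Finset.sum_eq_zero]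
        · simp [hpN n (by omega)]
        · intro b hb
          rw [Finset.mem_range] at hb
          rw [if_neg (by omega), mul_zero]
    · rw [Finset.sum_eq_zero, if_neg hm]
      · simp
      · intro b hb
        rw [if_neg (by omega), mul_zero]
  rw [hI, ← Complex.ofReal_sub, Complex.norm_real, Real.norm_eq_abs, ← mul_sub, abs_mul,
    abs_of_pos (by positivity : 0 < 2 * π)] at key
  set Y := |(if 0 ≤ m then p m.toNat else 0) -
      (Real.sqrt (2 * π * D))⁻¹ * Real.exp (-((m : ℝ) - μ) ^ 2 / (2 * D))|
  have hD0 : 0 < D := by linarith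
  rw [le_div_iff₀ (by positivity)] at key ⊢
  have h4 : π ^ 4 ≤ 200 := by
    have : π ≤ 3.15 := Real.pi_lt_d2.le
    calc π ^ 4 ≤ 3.15 ^ 4 := by gcongr
      _ ≤ 200 := by norm_num
  linarith

section HL
set_option linter.unusedSectionVars false
variable {V E : Type*} [Fintype E] [DecidableEq V] [DecidableEq E]

/-- edges sharing an endpoint -/
def Adj2 (v1 v2 : E → V) (e f : E) : Prop :=
  (v1 f = v1 e ∨ v2 f = v1 e) ∨ (v1 f = v2 e ∨ v2 f = v2 e)

/-- matchings inside a vertex set -/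
def Mt (v1 v2 : E → V) (A : Finset V) (M : Finset E) : Prop :=
  (∀ e ∈ M, ∀ f ∈ M, e ≠ f → ¬ Adj2 v1 v2 e f) ∧ ∀ e ∈ M, v1 e ∈ A ∧ v2 e ∈ A

theorem match_iff (v1 v2 : E → V) (M : Finset E) :
    (∀ v, degIn v1 v2 M v ≤ 1) ↔ (∀ e ∈ M, ∀ f ∈ M, e ≠ f → ¬ Adj2 v1 v2 e f) := by
  unfold degIn
  simp only [Finset.card_le_one, Finset.mem_filter]
  constructor
  · intro h e he f hf hne hadj
    rcases hadj with hadj | hadj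
    · exact hne (h (v1 e) e ⟨he, Or.inl rfl⟩ f ⟨hf, hadj⟩)
    · exact hne (h (v2 e) e ⟨he, Or.inr rfl⟩ f ⟨hf, hadj⟩)
  · intro h v e he f hf
    by_contra hne
    apply h e he.1 f hf.1 hne
    unfold Adj2
    rcases he.2 with h1 | h1 <;> rw [h1]
    · exact Or.inl hf.2
    · exact Or.inr hf.2

open Classical in
/-- all matchings -/
noncomputable def Om (v1 v2 : E → V) (A : Finset V) : Finset (Finset E) :=
  Finset.univ.filter (Mt v1 v2 A)

/-- matching polynomial of the induced graph on `A` -/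
noncomputable def FF (v1 v2 : E → V) (A : Finset V) (z : ℂ) : ℂ :=
  ∑ M ∈ Om v1 v2 A, z ^ M.card

theorem mem_Om (v1 v2 : E → V) (A : Finset V) (M : Finset E) :
    M ∈ Om v1 v2 A ↔ Mt v1 v2 A M := by
  unfold Om; simp

theorem FF_rec (v1 v2 : E → V) (hne : ∀ e, v1 e ≠ v2 e) (A : Finset V) (v : V) (z : ℂ) :
    FF v1 v2 A z = FF v1 v2 (A.erase v) z +
      ∑ e ∈ Finset.univ.filter (fun e => (v1 e = v ∨ v2 e = v) ∧ v1 e ∈ A ∧ v2 e ∈ A),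
        z * FF v1 v2 ((A.erase (v1 e)).erase (v2 e)) z := by
  classical
  unfold FF
  rw [← Finset.sum_filter_add_sum_filter_not (Om v1 v2 A) (fun M => ∀ e ∈ M, ¬ (v1 e = v ∨ v2 e = v))]
  congr 1
  · apply Finset.sum_congr _ fun _ _ => rfl
    ext M
    simp only [Finset.mem_filter, mem_Om, Mt, Finset.mem_erase]
    grind
  · simp only [Finset.mul_sum]
    rw [Finset.sum_sigma']
    symm
    refine Finset.sum_bij (fun x _ => insert x.1 x.2) ?_ ?_ ?_ ?_
    · rintro ⟨e, M⟩ h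
      simp only [Finset.mem_sigma, Finset.mem_filter, mem_Om, Mt, Finset.mem_erase, Adj2, Finset.mem_univ, true_and] at h ⊢
      grind
    · rintro ⟨e, M⟩ h ⟨f, M'⟩ h' heq
      simp only [Finset.mem_sigma, Finset.mem_filter, mem_Om, Mt, Finset.mem_erase, Adj2, Finset.mem_univ, true_and] at h h' heq
      have h1 : e ∉ M := by grind
      have h2 : f ∉ M' := by grind
      have hef : e = f := by
        have : e ∈ insert f M' := heq ▸ Finset.mem_insert_self e M
        rcases Finset.mem_insert.1 this with h3 | h3
        · exact h3
        · exfalso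
          grind
      subst hef
      have : M = M' := by
        rw [← Finset.erase_insert h1, heq, Finset.erase_insert h2]
      rw [this]
    · intro M hM
      simp only [Finset.mem_filter, mem_Om, not_forall, not_not] at hM
      obtain ⟨hM, e, he, hev⟩ := hM
      refine ⟨⟨e, M.erase e⟩, ?_, Finset.insert_erase he⟩
      simp only [Finset.mem_sigma, Finset.mem_filter, mem_Om, Mt, Finset.mem_erase, Adj2, Finset.mem_univ, true_and] at hM ⊢
      refine ⟨⟨hev, hM.2 e he⟩, fun a ha b hb => hM.1 a ha.2 b hb.2, fun a ha => ?_⟩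
      have h1 := hM.1 e he a ha.2 (Ne.symm ha.1)
      have h2 := hM.2 a ha.2
      grind
    · rintro ⟨e, M⟩ h
      simp only [Finset.mem_sigma, Finset.mem_filter, mem_Om, Mt, Finset.mem_erase, Finset.mem_univ, true_and] at h
      have h1 : e ∉ M := by grind
      rw [Finset.card_insert_of_notMem h1, pow_succ']

theorem FF_empty (v1 v2 : E → V) (z : ℂ) : FF v1 v2 ∅ z = 1 := by
  have : Om v1 v2 ∅ = {∅} := by
    ext M
    simp only [mem_Om, Mt, Finset.mem_singleton, Finset.notMem_empty, and_self, imp_false]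
    constructor
    · intro h; exact Finset.eq_empty_of_forall_notMem h.2
    · rintro rfl; simp
  simp [FF, this]

theorem re_inv_pos {a : ℂ} (h : 0 < a.re) : 0 < (a⁻¹).re := by
  rw [Complex.inv_re]
  apply div_pos h
  rw [Complex.normSq_pos]
  rintro rfl; simp at h

theorem heilmann_lieb (v1 v2 : E → V) (hne : ∀ e, v1 e ≠ v2 e) (w : ℂ) (hw : 0 < w.re) :
    ∀ n : ℕ, ∀ A : Finset V, A.card = n → FF v1 v2 A (w ^ 2) ≠ 0 ∧
      ∀ v ∈ A, 0 < (FF v1 v2 A (w ^ 2) / (w * FF v1 v2 (A.erase v) (w ^ 2))).re := by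
  have hw0 : w ≠ 0 := by rintro rfl; simp at hw
  intro n
  induction n using Nat.strong_induction_on with
  | _ n ih =>
    intro A hA
    have key : ∀ v ∈ A, 0 < (FF v1 v2 A (w ^ 2) / (w * FF v1 v2 (A.erase v) (w ^ 2))).re := by
      intro v hv
      have hc : (A.erase v).card < n := by rw [← hA]; exact Finset.card_erase_lt_of_mem hv
      obtain ⟨hB, hBr⟩ := ih _ hc (A.erase v) rfl
      have e : FF v1 v2 A (w ^ 2) / (w * FF v1 v2 (A.erase v) (w ^ 2)) = w⁻¹ +
          ∑ e ∈ Finset.univ.filter (fun e => (v1 e = v ∨ v2 e = v) ∧ v1 e ∈ A ∧ v2 e ∈ A),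
            (w * FF v1 v2 ((A.erase (v1 e)).erase (v2 e)) (w ^ 2)) / FF v1 v2 (A.erase v) (w ^ 2) := by
        rw [FF_rec v1 v2 hne A v, add_div, Finset.sum_div]
        congr 1
        · field_simp
        · refine Finset.sum_congr rfl fun e _ => ?_
          field_simp
      rw [e, Complex.add_re, Complex.re_sum]
      refine add_pos_of_pos_of_nonneg (re_inv_pos hw) (Finset.sum_nonneg fun e he => ?_)
      rw [Finset.mem_filter] at he
      have hne' := hne e
      rw [← inv_div]
      refine (re_inv_pos ?_).le
      obtain ⟨-, h1 | h1, h2, h3⟩ := he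
      · rw [h1]
        exact hBr (v2 e) (Finset.mem_erase.2 ⟨by rw [← h1]; exact hne'.symm, h3⟩)
      · rw [Finset.erase_right_comm, h1]
        exact hBr (v1 e) (Finset.mem_erase.2 ⟨by rw [← h1]; exact hne', h2⟩)
    refine ⟨?_, key⟩
    rcases A.eq_empty_or_nonempty with rfl | ⟨v, hv⟩
    · rw [FF_empty]; exact one_ne_zero
    · intro h0
      have := key v hv
      rw [h0] at this
      simp at this

theorem FF_root (v1 v2 : E → V) (hne : ∀ e, v1 e ≠ v2 e) (A : Finset V) (z : ℂ)
    (hz : FF v1 v2 A z = 0) : z.re < 0 ∧ z.im = 0 := by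
  have h0 : z ≠ 0 := by
    rintro rfl
    unfold FF at hz
    rw [Finset.sum_eq_single ∅] at hz
    · simp at hz
    · intro M _ hM
      exact zero_pow (by simpa using hM)
    · intro h; exact absurd ((mem_Om _ _ _ _).2 (by simp [Mt])) h
  have hs : z ∉ Complex.slitPlane := by
    intro hs
    have harg := Complex.mem_slitPlane_iff_arg.1 hs
    have h1 := Complex.neg_pi_lt_arg z
    have h2 : z.arg < π := lt_of_le_of_ne (Complex.arg_le_pi z) harg.1
    have hw : 0 < (Complex.exp (Complex.log z / 2)).re := by
      rw [Complex.exp_re]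
      refine mul_pos (Real.exp_pos _) (Real.cos_pos_of_mem_Ioo ?_)
      have : (Complex.log z / 2).im = z.arg / 2 := by
        rw [show (2 : ℂ) = ((2 : ℝ) : ℂ) by norm_num, Complex.div_ofReal_im, Complex.log_im]
      rw [this]
      constructor <;> linarith
    have := (heilmann_lieb v1 v2 hne _ hw _ A rfl).1
    rw [← Complex.exp_nat_mul, show ((2 : ℕ) : ℂ) * (Complex.log z / 2) = Complex.log z by push_cast; ring,
      Complex.exp_log h0] at this
    exact this hz
  rw [Complex.mem_slitPlane_iff] at hs
  push Not at hs
  refine ⟨lt_of_le_of_ne hs.1 fun h => h0 (Complex.ext h hs.2), hs.2⟩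

end HL

section VAR
set_option linter.unusedSectionVars false
variable {V E : Type*} [Fintype E] [DecidableEq V] [DecidableEq E]

theorem adj_self (v1 v2 : E → V) (e : E) : Adj2 v1 v2 e e := Or.inl (Or.inl rfl)

theorem adj_symm (v1 v2 : E → V) (e f : E) (h : Adj2 v1 v2 e f) : Adj2 v1 v2 f e := by
  unfold Adj2 at *; grind

open Classical in
/-- matchings avoiding the neighbourhood of `e` -/
noncomputable def Om0 (v1 v2 : E → V) (A : Finset V) (e : E) : Finset (Finset E) :=
  (Om v1 v2 A).filter (fun M => ∀ f ∈ M, ¬ Adj2 v1 v2 e f)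

open Classical in
/-- test function -/
noncomputable def fe (v1 v2 : E → V) (e : E) (M : Finset E) : ℝ :=
  (if e ∈ M then 1 else 0) - (if ∀ f ∈ M, ¬ Adj2 v1 v2 e f then 1 else 0)

theorem sum_fe (v1 v2 : E → V) (A : Finset V) (e : E) (h1 : v1 e ∈ A) (h2 : v2 e ∈ A)
    (h : Finset E → ℝ) :
    ∑ M ∈ Om v1 v2 A, fe v1 v2 e M * h M = ∑ M ∈ Om0 v1 v2 A e, (h (insert e M) - h M) := by
  classical
  have hbij : ∑ M ∈ (Om v1 v2 A).filter (fun M => e ∈ M), h M = ∑ M ∈ Om0 v1 v2 A e, h (insert e M) := by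
    symm
    refine Finset.sum_bij' (fun M _ => insert e M) (fun M _ => M.erase e) ?_ ?_ ?_ ?_ ?_
    · intro M hM
      simp only [Om0, Finset.mem_filter, mem_Om, Mt] at hM ⊢
      refine ⟨⟨?_, ?_⟩, Finset.mem_insert_self _ _⟩
      · intro a ha b hb hab
        rw [Finset.mem_insert] at ha hb
        rcases ha with rfl | ha <;> rcases hb with rfl | hb
        · exact absurd rfl hab
        · exact hM.2 b hb
        · exact fun hh => hM.2 a ha (adj_symm _ _ _ _ hh)
        · exact hM.1.1 a ha b hb hab
      · intro a ha
        rw [Finset.mem_insert] at ha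
        rcases ha with rfl | ha
        · exact ⟨h1, h2⟩
        · exact hM.1.2 a ha
    · intro M hM
      simp only [Om0, Finset.mem_filter, mem_Om, Mt] at hM ⊢
      refine ⟨⟨fun a ha b hb => hM.1.1 a (Finset.mem_of_mem_erase ha) b (Finset.mem_of_mem_erase hb),
        fun a ha => hM.1.2 a (Finset.mem_of_mem_erase ha)⟩, fun f hf => ?_⟩
      exact hM.1.1 e hM.2 f (Finset.mem_of_mem_erase hf) (Finset.ne_of_mem_erase hf).symm
    · intro M hM
      simp only [Om0, Finset.mem_filter] at hM
      exact Finset.erase_insert fun he => hM.2 e he (adj_self _ _ _)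
    · intro M hM
      exact Finset.insert_erase (Finset.mem_filter.1 hM).2
    · intro M hM; rfl
  rw [Finset.sum_sub_distrib, ← hbij]
  unfold fe Om0
  simp only [sub_mul, ite_mul, one_mul, zero_mul, Finset.sum_sub_distrib, Finset.sum_filter]

theorem fe_insert_self (v1 v2 : E → V) (A : Finset V) (e : E) (M : Finset E) (hM : M ∈ Om0 v1 v2 A e) :
    fe v1 v2 e (insert e M) - fe v1 v2 e M = 2 := by
  classical
  have hM2 : ∀ f ∈ M, ¬ Adj2 v1 v2 e f := by
    unfold Om0 at hM; exact (Finset.mem_filter.1 hM).2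
  have he : e ∉ M := fun he => hM2 e he (adj_self _ _ _)
  have hn : ¬ ∀ f ∈ insert e M, ¬ Adj2 v1 v2 e f := fun h => h e (Finset.mem_insert_self _ _) (adj_self _ _ _)
  unfold fe
  rw [if_pos (Finset.mem_insert_self _ _), if_neg hn, if_neg he, if_pos hM2]
  norm_num

theorem fe_insert_other (v1 v2 : E → V) (e e' : E) (M : Finset E) (h : ¬ Adj2 v1 v2 e' e) :
    fe v1 v2 e' (insert e M) - fe v1 v2 e' M = 0 := by
  have hne : e' ≠ e := by rintro rfl; exact h (adj_self _ _ _)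
  have hiff : (∀ f ∈ insert e M, ¬ Adj2 v1 v2 e' f) ↔ ∀ f ∈ M, ¬ Adj2 v1 v2 e' f := by
    rw [Finset.forall_mem_insert]
    exact and_iff_right h
  have hmem : e' ∈ insert e M ↔ e' ∈ M := by
    rw [Finset.mem_insert]
    exact or_iff_right hne
  classical
  unfold fe
  by_cases h1 : e' ∈ M <;> by_cases h2 : ∀ f ∈ M, ¬ Adj2 v1 v2 e' f
  · rw [if_pos (hmem.2 h1), if_pos h1, if_pos (hiff.2 h2), if_pos h2]; ring
  · rw [if_pos (hmem.2 h1), if_pos h1, if_neg (fun h => h2 (hiff.1 h)), if_neg h2]; ring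
  · rw [if_neg (fun h => h1 (hmem.1 h)), if_neg h1, if_pos (hiff.2 h2), if_pos h2]; ring
  · rw [if_neg (fun h => h1 (hmem.1 h)), if_neg h1, if_neg (fun h => h2 (hiff.1 h)), if_neg h2]; ring

theorem var_lower (v1 v2 : E → V) (A : Finset V) (S : Finset E) (hS : S ∈ Om v1 v2 A) (μ : ℝ) :
    (∑ e ∈ S, ((Om0 v1 v2 A e).card : ℝ)) / 2 ≤ ∑ M ∈ Om v1 v2 A, ((M.card : ℝ) - μ) ^ 2 := by
  classical
  rw [mem_Om] at hS
  set g : Finset E → ℝ := fun M => ∑ e ∈ S, fe v1 v2 e M with hg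
  have hsum : ∀ h : Finset E → ℝ, ∑ M ∈ Om v1 v2 A, g M * h M =
      ∑ e ∈ S, ∑ M ∈ Om0 v1 v2 A e, (h (insert e M) - h M) := by
    intro h
    simp only [hg, Finset.sum_mul]
    rw [Finset.sum_comm]
    exact Finset.sum_congr rfl fun e he => sum_fe v1 v2 A e (hS.2 e he).1 (hS.2 e he).2 h
  have hA : ∑ M ∈ Om v1 v2 A, g M * ((M.card : ℝ) - μ) = ∑ e ∈ S, ((Om0 v1 v2 A e).card : ℝ) := by
    rw [hsum (fun M => (M.card : ℝ) - μ)]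
    refine Finset.sum_congr rfl fun e he => ?_
    rw [Finset.sum_congr rfl (g := fun _ => (1 : ℝ))]
    · simp
    · intro M hM
      have : e ∉ M := by
        unfold Om0 at hM
        exact fun he => (Finset.mem_filter.1 hM).2 e he (adj_self _ _ _)
      rw [Finset.card_insert_of_notMem this]; push_cast; ring
  have hB : ∑ M ∈ Om v1 v2 A, g M * g M = 2 * ∑ e ∈ S, ((Om0 v1 v2 A e).card : ℝ) := by
    rw [hsum g, Finset.mul_sum]
    refine Finset.sum_congr rfl fun e he => ?_
    rw [Finset.sum_congr rfl (g := fun _ => (2 : ℝ))]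
    · simp; ring
    · intro M hM
      simp only [hg]
      rw [← Finset.sum_sub_distrib, Finset.sum_eq_single e]
      · exact fe_insert_self v1 v2 A e M hM
      · intro b hb hbe
        exact fe_insert_other v1 v2 e b M (hS.1 b hb e he hbe)
      · intro h; exact absurd he h
  have hpos : 0 ≤ ∑ M ∈ Om v1 v2 A, ((M.card : ℝ) - μ - g M / 2) ^ 2 :=
    Finset.sum_nonneg fun _ _ => sq_nonneg _
  have hex : ∑ M ∈ Om v1 v2 A, ((M.card : ℝ) - μ - g M / 2) ^ 2 =
      ∑ M ∈ Om v1 v2 A, ((M.card : ℝ) - μ) ^ 2 - ∑ M ∈ Om v1 v2 A, g M * ((M.card : ℝ) - μ)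
        + (∑ M ∈ Om v1 v2 A, g M * g M) / 4 := by
    rw [Finset.sum_div, ← Finset.sum_sub_distrib, ← Finset.sum_add_distrib]
    refine Finset.sum_congr rfl fun M _ => ?_
    ring
  rw [hex, hA, hB] at hpos
  linarith

theorem card_Om_le (v1 v2 : E → V) (A : Finset V) (d : ℕ)
    (hd : ∀ v, degIn v1 v2 Finset.univ v ≤ d) (e : E) :
    (Om v1 v2 A).card ≤ (Om0 v1 v2 A e).card * ((d + 1) * (d + 1)) := by
  classical
  set I : V → Finset E := fun v => Finset.univ.filter (fun f => v1 f = v ∨ v2 f = v) with hI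
  set P : V → Finset (Finset E) := fun v => insert ∅ ((I v).image (fun f => {f})) with hP
  have hPc : ∀ v, (P v).card ≤ d + 1 := by
    intro v
    refine (Finset.card_insert_le _ _).trans ?_
    have := (Finset.card_image_le (s := I v) (f := fun f => ({f} : Finset E))).trans (hd v)
    omega
  have hmemP : ∀ M ∈ Om v1 v2 A, ∀ v, M.filter (fun f => v1 f = v ∨ v2 f = v) ∈ P v := by
    intro M hM v
    rw [mem_Om] at hM
    have h1 : (M.filter (fun f => v1 f = v ∨ v2 f = v)).card ≤ 1 := (match_iff v1 v2 M).2 hM.1 v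
    simp only [hP, hI, Finset.mem_insert, Finset.mem_image, Finset.mem_filter, Finset.mem_univ, true_and]
    rcases Nat.le_one_iff_eq_zero_or_eq_one.1 h1 with h | h
    · left; exact Finset.card_eq_zero.1 h
    · right
      obtain ⟨a, ha⟩ := Finset.card_eq_one.1 h
      refine ⟨a, ?_, ha.symm⟩
      have : a ∈ M.filter (fun f => v1 f = v ∨ v2 f = v) := by rw [ha]; simp
      exact (Finset.mem_filter.1 this).2
  calc (Om v1 v2 A).card ≤ (Om0 v1 v2 A e ×ˢ (P (v1 e) ×ˢ P (v2 e))).card := by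
        refine Finset.card_le_card_of_injOn (fun M => (M.filter (fun f => ¬ Adj2 v1 v2 e f),
          M.filter (fun f => v1 f = v1 e ∨ v2 f = v1 e), M.filter (fun f => v1 f = v2 e ∨ v2 f = v2 e))) ?_ ?_
        · intro M hM
          have hM' : M ∈ Om v1 v2 A := hM
          simp only [Finset.coe_product, Set.mem_prod, Finset.mem_coe]
          refine ⟨?_, hmemP M hM' _, hmemP M hM' _⟩
          rw [mem_Om] at hM'
          unfold Om0
          rw [Finset.mem_filter, mem_Om]
          refine ⟨⟨fun a ha b hb => hM'.1 a (Finset.mem_filter.1 ha).1 b (Finset.mem_filter.1 hb).1,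
            fun a ha => hM'.2 a (Finset.mem_filter.1 ha).1⟩, fun f hf => (Finset.mem_filter.1 hf).2⟩
        · intro M _ M' _ heq
          simp only [Prod.mk.injEq] at heq
          obtain ⟨ha, hb, hc⟩ := heq
          ext f
          have ha' := Finset.ext_iff.1 ha f
          have hb' := Finset.ext_iff.1 hb f
          have hc' := Finset.ext_iff.1 hc f
          simp only [Finset.mem_filter] at ha' hb' hc'
          by_cases had : Adj2 v1 v2 e f
          · rcases had with had | had
            · exact ⟨fun h => (hb'.1 ⟨h, had⟩).1, fun h => (hb'.2 ⟨h, had⟩).1⟩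
            · exact ⟨fun h => (hc'.1 ⟨h, had⟩).1, fun h => (hc'.2 ⟨h, had⟩).1⟩
          · exact ⟨fun h => (ha'.1 ⟨h, had⟩).1, fun h => (ha'.2 ⟨h, had⟩).1⟩
    _ = (Om0 v1 v2 A e).card * ((P (v1 e)).card * (P (v2 e)).card) := by
        rw [Finset.card_product, Finset.card_product]
    _ ≤ _ := Nat.mul_le_mul_left _ (Nat.mul_le_mul (hPc _) (hPc _))

theorem exists_big (v1 v2 : E → V) [Fintype V] (d : ℕ)
    (hd : ∀ v, degIn v1 v2 Finset.univ v ≤ d) :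
    ∃ S ∈ Om v1 v2 Finset.univ, Fintype.card E ≤ S.card * (2 * d) := by
  classical
  obtain ⟨S, hS, hmax⟩ := Finset.exists_max_image (Om v1 v2 Finset.univ) Finset.card
    ⟨∅, (mem_Om _ _ _ _).2 (by simp [Mt])⟩
  refine ⟨S, hS, ?_⟩
  rw [mem_Om] at hS
  have hcov : ∀ e, ∃ s ∈ S, Adj2 v1 v2 s e := by
    intro e
    by_contra hno
    push Not at hno
    have he : e ∉ S := fun he => hno e he (adj_self _ _ _)
    have := hmax (insert e S) ((mem_Om _ _ _ _).2 ⟨?_, by simp⟩)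
    · rw [Finset.card_insert_of_notMem he] at this; omega
    · intro a ha b hb hab
      rw [Finset.mem_insert] at ha hb
      rcases ha with rfl | ha <;> rcases hb with rfl | hb
      · exact absurd rfl hab
      · exact fun hh => hno b hb (adj_symm _ _ _ _ hh)
      · exact hno a ha
      · exact hS.1 a ha b hb hab
  set I : V → Finset E := fun v => Finset.univ.filter (fun f => v1 f = v ∨ v2 f = v) with hI
  have hsub : (Finset.univ : Finset E) ⊆ S.biUnion (fun s => I (v1 s) ∪ I (v2 s)) := by
    intro e _
    obtain ⟨s, hs, hadj⟩ := hcov e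
    rw [Finset.mem_biUnion]
    refine ⟨s, hs, ?_⟩
    simpa [hI, Adj2] using hadj
  calc Fintype.card E = (Finset.univ : Finset E).card := rfl
    _ ≤ _ := Finset.card_le_card hsub
    _ ≤ S.card * (2 * d) := by
      refine Finset.card_biUnion_le_card_mul _ _ _ fun s _ => ?_
      refine (Finset.card_union_le _ _).trans ?_
      have h1 : (I (v1 s)).card ≤ d := hd (v1 s)
      have h2 : (I (v2 s)).card ≤ d := hd (v2 s)
      omega

end VAR

section FIN
set_option linter.unusedSectionVars false
open Polynomial in
theorem prod_moments {ι : Type*} (s : Finset ι) (q : ι → ℝ) :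
    (∏ i ∈ s, (C (1 - q i) + C (q i) * X)).eval 1 = 1 ∧
    (derivative (∏ i ∈ s, (C (1 - q i) + C (q i) * X))).eval 1 = ∑ i ∈ s, q i ∧
    (derivative (derivative (∏ i ∈ s, (C (1 - q i) + C (q i) * X)))).eval 1 =
      (∑ i ∈ s, q i) ^ 2 - ∑ i ∈ s, q i ^ 2 := by
  classical
  induction s using Finset.induction_on with
  | empty => simp
  | insert a s ha ih =>
    obtain ⟨h0, h1, h2⟩ := ih
    rw [Finset.prod_insert ha, Finset.sum_insert ha, Finset.sum_insert ha]
    refine ⟨?_, ?_, ?_⟩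
    · simp only [eval_mul, h0, eval_add, eval_C, eval_X]; ring
    · simp only [derivative_mul, derivative_add, derivative_C, derivative_X, eval_mul, eval_add,
        eval_C, eval_X, eval_zero, eval_one, h0, h1]; ring
    · simp only [derivative_mul, derivative_add, derivative_C, derivative_X, derivative_zero,
        derivative_one, eval_mul, eval_add,
        eval_C, eval_X, eval_zero, eval_one, h0, h1, h2]; ring

open Polynomial in
theorem moments_of_id {ι : Type*} [Fintype ι] (q : ι → ℝ) (N : ℕ) (p : ℕ → ℝ)
    (hp : ∀ z : ℂ, ∑ k ∈ Finset.range N, (p k : ℂ) * z ^ k = ∏ i, (1 - q i + q i * z)) :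
    ∑ k ∈ Finset.range N, p k = 1 ∧ ∑ k ∈ Finset.range N, (k : ℝ) * p k = ∑ i, q i ∧
    ∑ k ∈ Finset.range N, (k : ℝ) ^ 2 * p k = ∑ i, q i + (∑ i, q i) ^ 2 - ∑ i, q i ^ 2 := by
  have hid : ∑ k ∈ Finset.range N, C (p k) * X ^ k = ∏ i, (C (1 - q i) + C (q i) * X) := by
    apply Polynomial.funext
    intro x
    apply Complex.ofReal_injective
    have := hp x
    simp only [eval_finsetSum, eval_prod, eval_mul, eval_add, eval_pow, eval_C, eval_X]
    push_cast
    exact this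
  obtain ⟨h0, h1, h2⟩ := prod_moments Finset.univ q
  rw [← hid] at h0 h1 h2
  simp only [eval_finsetSum, eval_mul, eval_pow, eval_C, eval_X, one_pow, mul_one] at h0
  simp only [derivative_sum, derivative_C_mul, derivative_X_pow, eval_finsetSum, eval_mul, eval_pow, eval_C, eval_X, one_pow, mul_one] at h1 h2
  have e1 : ∑ k ∈ Finset.range N, (k : ℝ) * p k = ∑ i, q i := by
    rw [← h1]; exact Finset.sum_congr rfl fun k _ => mul_comm _ _
  refine ⟨h0, e1, ?_⟩
  have : ∑ k ∈ Finset.range N, (k : ℝ) ^ 2 * p k = ∑ k ∈ Finset.range N, (k : ℝ) * p k +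
      ((∑ i, q i) ^ 2 - ∑ i, q i ^ 2) := by
    rw [← h2, ← Finset.sum_add_distrib]
    refine Finset.sum_congr rfl fun k _ => ?_
    rcases k with _ | k
    · simp
    · simp only [Nat.add_sub_cancel]; push_cast; ring
  rw [this, e1]; ring

open Polynomial in
theorem factor_poly (N : ℕ) (p : ℕ → ℝ) (hN : ∑ k ∈ Finset.range N, p k = 1)
    (hroot : ∀ z : ℂ, ∑ k ∈ Finset.range N, (p k : ℂ) * z ^ k = 0 → z.re < 0 ∧ z.im = 0) :
    ∃ (n : ℕ) (q : Fin n → ℝ), (∀ i, 0 ≤ q i) ∧ (∀ i, q i ≤ 1) ∧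
      ∀ z : ℂ, ∑ k ∈ Finset.range N, (p k : ℂ) * z ^ k = ∏ i, (1 - q i + q i * z) := by
  set P : ℂ[X] := ∑ k ∈ Finset.range N, C (p k : ℂ) * X ^ k with hP
  have hev : ∀ z, P.eval z = ∑ k ∈ Finset.range N, (p k : ℂ) * z ^ k := by
    intro z
    simp only [hP, eval_finsetSum, eval_mul, eval_pow, eval_C, eval_X]
  have h1 : P.eval 1 = 1 := by
    rw [hev]; simp only [one_pow, mul_one]; exact_mod_cast congrArg (fun x : ℝ => (x : ℂ)) hN
  have hP0 : P ≠ 0 := by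
    intro h; rw [h] at h1; simp at h1
  have hprod : ∀ z, P.eval z = P.leadingCoeff * (P.roots.map (fun r => z - r)).prod := by
    intro z
    exact (IsAlgClosed.splits P).eval_eq_prod_roots z
  set L := P.roots.toList with hL
  have hLr : ∀ f : ℂ → ℂ, (P.roots.map f).prod = ∏ i : Fin L.length, f (L.get i) := by
    intro f
    rw [← Multiset.coe_toList P.roots, Multiset.map_coe, Multiset.prod_coe, ← hL,
      ← List.prod_ofFn]
    congr 1
    conv_lhs => rw [← List.ofFn_get L, List.map_ofFn]
    rfl
  have hr : ∀ i : Fin L.length, (L.get i).re < 0 ∧ (L.get i).im = 0 := by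
    intro i
    apply hroot
    rw [← hev]
    have : L.get i ∈ P.roots := by rw [← Multiset.mem_toList]; exact List.get_mem _ _
    exact (mem_roots hP0).1 this
  refine ⟨L.length, fun i => 1 / (1 - (L.get i).re), ?_, ?_, ?_⟩
  · intro i
    have := (hr i).1
    apply div_nonneg <;> linarith
  · intro i
    have := (hr i).1
    rw [div_le_one] <;> linarith
  · intro z
    rw [← hev]
    have hz := hprod z
    have ho := hprod 1
    rw [hLr] at hz ho
    rw [h1] at ho
    have hne : ∏ i : Fin L.length, (1 - L.get i) ≠ 0 := by
      intro h; rw [h] at ho; simp at ho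
    have hlc : P.leadingCoeff = (∏ i : Fin L.length, (1 - L.get i))⁻¹ := by
      field_simp; exact ho.symm
    rw [hz, hlc, ← Finset.prod_inv_distrib, ← Finset.prod_mul_distrib]
    refine Finset.prod_congr rfl fun i _ => ?_
    have hri : L.get i = ((L.get i).re : ℂ) := by
      exact Complex.ext (Complex.ofReal_re _).symm ((hr i).2.trans (Complex.ofReal_im _).symm)
    have hne1 : (1 - ((L.get i).re : ℂ)) ≠ 0 := by
      have h3 : (1 - (L.get i).re) ≠ 0 := by have := (hr i).1; linarith
      exact_mod_cast h3
    rw [hri]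
    simp only [Complex.ofReal_re]
    push_cast
    field_simp
    ring

theorem sum_matchCount {V E K : Type*} [Fintype V] [Fintype E] [DecidableEq V] [DecidableEq E] [CommSemiring K]
    (v1 v2 : E → V) (h : ℕ → K) :
    ∑ m ∈ Finset.range (Fintype.card E + 1), h m * (matchCount v1 v2 m : K) =
      ∑ M ∈ Om v1 v2 Finset.univ, h M.card := by
  have hmc : ∀ m, matchCount v1 v2 m = ((Om v1 v2 Finset.univ).filter (fun M => M.card = m)).card := by
    intro m
    unfold matchCount
    congr 1
    ext M
    rw [Finset.mem_filter, Finset.mem_filter, mem_Om, match_iff]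
    simp [Mt]
  rw [← Finset.sum_fiberwise_of_maps_to (s := Om v1 v2 Finset.univ)
    (t := Finset.range (Fintype.card E + 1)) (g := Finset.card)]
  · refine Finset.sum_congr rfl fun m _ => ?_
    rw [hmc, Finset.sum_congr rfl (g := fun _ => h m)]
    · rw [Finset.sum_const, nsmul_eq_mul, mul_comm]
    · intro M hM
      rw [(Finset.mem_filter.1 hM).2]
  · intro M _
    rw [Finset.mem_range]
    exact Nat.lt_succ_of_le (Finset.card_le_univ M)

theorem matchCount_big {V E : Type*} [Fintype V] [Fintype E] [DecidableEq V] [DecidableEq E]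
    (v1 v2 : E → V) (k : ℕ) (hk : Fintype.card E + 1 ≤ k) : matchCount v1 v2 k = 0 := by
  unfold matchCount
  rw [Finset.card_eq_zero, Finset.filter_eq_empty_iff]
  rintro M _ ⟨_, h⟩
  have := Finset.card_le_univ M
  omega

theorem var_bound {V E : Type*} [Fintype V] [Fintype E] [DecidableEq V] [DecidableEq E]
    (v1 v2 : E → V) (d : ℕ) (hd2 : 2 ≤ d) (hd : ∀ v, degIn v1 v2 Finset.univ v ≤ d) :
    (Fintype.card E : ℝ) ≤ 8 * (d : ℝ) ^ 4 * mVar v1 v2 := by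
  set O := Om v1 v2 Finset.univ with hO
  have hT : mTotal v1 v2 = (O.card : ℝ) := by
    have := sum_matchCount v1 v2 (fun _ => (1 : ℝ))
    simp only [one_mul, Finset.sum_const, nsmul_eq_mul, mul_one] at this
    exact this
  have hTpos : (0 : ℝ) < O.card := by
    have : ∅ ∈ O := (mem_Om _ _ _ _).2 (by simp [Mt])
    exact_mod_cast Finset.card_pos.2 ⟨_, this⟩
  have h1 : mEX v1 v2 * O.card = ∑ M ∈ O, (M.card : ℝ) := by
    rw [← sum_matchCount v1 v2 (fun m => (m : ℝ))]
    unfold mEX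
    rw [hT]; field_simp
  have h2 : mVar v1 v2 * O.card = ∑ M ∈ O, ((M.card : ℝ) - mEX v1 v2) ^ 2 := by
    have e : ∑ M ∈ O, ((M.card : ℝ) - mEX v1 v2) ^ 2 = ∑ M ∈ O, (M.card : ℝ) ^ 2 -
        2 * mEX v1 v2 * ∑ M ∈ O, (M.card : ℝ) + O.card * mEX v1 v2 ^ 2 := by
      rw [← nsmul_eq_mul, ← Finset.sum_const, Finset.mul_sum, ← Finset.sum_sub_distrib,
        ← Finset.sum_add_distrib]
      exact Finset.sum_congr rfl fun _ _ => by ring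
    rw [e, ← h1, ← sum_matchCount v1 v2 (fun m => (m : ℝ) ^ 2)]
    unfold mVar
    rw [hT]; field_simp; ring
  obtain ⟨S, hS, hSE⟩ := exists_big v1 v2 d hd
  have h3 := var_lower v1 v2 Finset.univ S hS (mEX v1 v2)
  rw [← hO, ← h2] at h3
  have hd1 : (0 : ℝ) < ((d : ℝ) + 1) * (d + 1) := by positivity
  have h4 : (S.card : ℝ) * O.card ≤ (∑ e ∈ S, ((Om0 v1 v2 Finset.univ e).card : ℝ)) * (((d : ℝ) + 1) * (d + 1)) := by
    rw [Finset.sum_mul, ← nsmul_eq_mul, ← Finset.sum_const]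
    refine Finset.sum_le_sum fun e _ => ?_
    exact_mod_cast card_Om_le v1 v2 Finset.univ d hd e
  have h5 : (S.card : ℝ) * O.card ≤ 2 * (((d : ℝ) + 1) * (d + 1)) * mVar v1 v2 * O.card := by
    nlinarith [mul_le_mul_of_nonneg_right h3 hd1.le]
  have h6 := le_of_mul_le_mul_right h5 hTpos
  have hv0 : 0 ≤ mVar v1 v2 := by
    have : 0 ≤ mVar v1 v2 * O.card := by rw [h2]; exact Finset.sum_nonneg fun _ _ => sq_nonneg _
    exact nonneg_of_mul_nonneg_left this hTpos
  have h7 : (Fintype.card E : ℝ) ≤ S.card * (2 * d) := by exact_mod_cast hSE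
  have hdr : (2 : ℝ) ≤ d := by exact_mod_cast hd2
  have h8 : 4 * (d : ℝ) * (((d : ℝ) + 1) * (d + 1)) ≤ 8 * (d : ℝ) ^ 4 := by
    have a : (((d : ℝ) + 1) * (d + 1)) ≤ 2 * (d : ℝ) ^ 3 := by
      nlinarith [mul_nonneg (sub_nonneg.2 hdr) (sq_nonneg (d : ℝ)), sq_nonneg ((d : ℝ) - 2)]
    nlinarith [mul_le_mul_of_nonneg_left a (by linarith : (0 : ℝ) ≤ 4 * d)]
  calc (Fintype.card E : ℝ) ≤ S.card * (2 * d) := h7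
    _ ≤ (2 * (((d : ℝ) + 1) * (d + 1)) * mVar v1 v2) * (2 * d) := by gcongr
    _ = (4 * (d : ℝ) * (((d : ℝ) + 1) * (d + 1))) * mVar v1 v2 := by ring
    _ ≤ _ := by gcongr

end FIN

/-- LCLT for the number of edges of a uniformly weighted random matching:
if `|E| ≥ 2.2×10⁸ d_max⁴` then the local Gaussian approximation holds with error
`200 d_max⁴/(π |E|)`. -/
theorem lclt_matchings {V E : Type*} [Fintype V] [Fintype E] [DecidableEq V] [DecidableEq E]
    (v1 v2 : E → V) (hne : ∀ e, v1 e ≠ v2 e)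
    (hdeg : ∀ v, 0 < degIn v1 v2 Finset.univ v)
    (dmax : ℕ) (hdmax2 : 2 ≤ dmax)
    (hdmax : ∀ v, degIn v1 v2 Finset.univ v ≤ dmax)
    (hE : 2.2 * 10 ^ 8 * (dmax : ℝ) ^ 4 ≤ (Fintype.card E : ℝ)) :
    ∀ m : ℤ,
      |mProb v1 v2 m -
          (Real.sqrt (2 * π * mVar v1 v2))⁻¹ *
            Real.exp (-((m : ℝ) - mEX v1 v2) ^ 2 / (2 * mVar v1 v2))| ≤
        200 * (dmax : ℝ) ^ 4 / (π * (Fintype.card E : ℝ)) := by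
  intro m
  have hvb := var_bound v1 v2 dmax hdmax2 hdmax
  have hd4 : (0 : ℝ) < (dmax : ℝ) ^ 4 := by positivity
  have hv1 : 1 ≤ mVar v1 v2 := by
    have h : 8 * (dmax : ℝ) ^ 4 * 1 ≤ 8 * (dmax : ℝ) ^ 4 * mVar v1 v2 := by linarith
    exact le_of_mul_le_mul_left h (by positivity)
  have hTpos : 0 < mTotal v1 v2 := by
    have := sum_matchCount v1 v2 (fun _ => (1 : ℝ))
    simp only [one_mul, Finset.sum_const, nsmul_eq_mul, mul_one] at this
    unfold mTotal
    rw [this]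
    have h0 : ∅ ∈ Om v1 v2 Finset.univ := (mem_Om _ _ _ _).2 (by simp [Mt])
    exact_mod_cast Finset.card_pos.2 ⟨_, h0⟩
  set p : ℕ → ℝ := fun k => (matchCount v1 v2 k : ℝ) / mTotal v1 v2 with hp
  have hp1 : ∑ k ∈ Finset.range (Fintype.card E + 1), p k = 1 := by
    simp only [hp]
    rw [← Finset.sum_div]
    exact div_self hTpos.ne'
  have hTc : (mTotal v1 v2 : ℂ) ≠ 0 := by exact_mod_cast hTpos.ne'
  have hFF : ∀ z : ℂ, ∑ k ∈ Finset.range (Fintype.card E + 1), (p k : ℂ) * z ^ k =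
      FF v1 v2 Finset.univ z / mTotal v1 v2 := by
    intro z
    have := sum_matchCount v1 v2 (fun k => z ^ k)
    unfold FF
    rw [← this, Finset.sum_div]
    refine Finset.sum_congr rfl fun k _ => ?_
    simp only [hp]
    push_cast
    ring
  obtain ⟨n, q, hq0, hq1, hq⟩ := factor_poly (Fintype.card E + 1) p hp1 (by
    intro z hz
    rw [hFF] at hz
    exact FF_root v1 v2 hne Finset.univ z ((div_eq_zero_iff.1 hz).resolve_right hTc))
  obtain ⟨_, hm1, hm2⟩ := moments_of_id q _ p hq
  have hEX : mEX v1 v2 = ∑ i, q i := by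
    rw [← hm1]
    unfold mEX
    rw [Finset.sum_div]
    exact Finset.sum_congr rfl fun k _ => by simp only [hp]; ring
  have hVar : mVar v1 v2 = ∑ i, q i * (1 - q i) := by
    have e : ∑ i, q i * (1 - q i) = ∑ i, q i - ∑ i, q i ^ 2 := by
      rw [← Finset.sum_sub_distrib]
      exact Finset.sum_congr rfl fun _ _ => by ring
    have e2 : (∑ m ∈ Finset.range (Fintype.card E + 1), (m : ℝ) ^ 2 * (matchCount v1 v2 m : ℝ)) /
        mTotal v1 v2 = ∑ k ∈ Finset.range (Fintype.card E + 1), (k : ℝ) ^ 2 * p k := by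
      rw [Finset.sum_div]
      exact Finset.sum_congr rfl fun k _ => by simp only [hp]; ring
    unfold mVar
    rw [e2, hm2, hEX, e]
    ring
  have hmain := lclt_bern q hq0 hq1 (Fintype.card E + 1) p hq (fun k hk => by
    simp only [hp]; rw [matchCount_big v1 v2 k hk]; simp) (mVar v1 v2) hVar hv1 (mEX v1 v2) hEX m
  have hcE : (0 : ℝ) < Fintype.card E := lt_of_lt_of_le (by positivity) hE
  refine le_trans hmain ?_
  rw [div_le_div_iff₀ (by positivity) (by positivity)]
  nlinarith [mul_le_mul_of_nonneg_left hvb Real.pi_pos.le]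
end

section
/- Let G be a finite graph (multiple edges allowed) with vertex set V and edge set E, every vertex of positive degree, and suppose C(v) = {0,1,…,k_v} with k_v ≥ 1 for every vertex v. Let P(z) = Σ_{m=0}^N p_m z^m be the graph-counting polynomial (of exact degree N), fix z_0 > 0, and set T_m = m!·p_m·z_0^m/P(z_0) and α = max_{v ∈ V} max(d_v − k_v, 0). Then for every m with 0 ≤ m ≤ N − 2, T_m > 0, T_{m+1} > 0, and T_{m+2}/T_{m+1} ≥ T_{m+1}/T_m − (2α + 1)·z_0. -/
open Finset

/-- `p_m`, the number of subgraphs `M` of `G` with exactly `m` edges satisfying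
`d_M(v) ∈ C(v) = {0,1,…,k_v}` for every vertex `v`. -/
def admCount {V E : Type*} [Fintype V] [Fintype E] [DecidableEq V] [DecidableEq E]
    (v1 v2 : E → V) (k : V → ℕ) (m : ℕ) : ℕ :=
  (Finset.univ.filter
    (fun M : Finset E => (∀ v, degIn v1 v2 M v ≤ k v) ∧ M.card = m)).card

/-- `N`, the number of edges of a largest admissible subgraph (the exact degree
of the graph-counting polynomial). -/
def admMax {V E : Type*} [Fintype V] [Fintype E] [DecidableEq V] [DecidableEq E]
    (v1 v2 : E → V) (k : V → ℕ) : ℕ :=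
  (Finset.univ.filter (fun M : Finset E => ∀ v, degIn v1 v2 M v ≤ k v)).sup Finset.card

/-- `P(z₀) = Σ_{m=0}^N p_m z₀^m`. -/
noncomputable def admPsum {V E : Type*} [Fintype V] [Fintype E] [DecidableEq V] [DecidableEq E]
    (v1 v2 : E → V) (k : V → ℕ) (z0 : ℝ) : ℝ :=
  ∑ m ∈ Finset.range (admMax v1 v2 k + 1), (admCount v1 v2 k m : ℝ) * z0 ^ m

/-- `T_m = m! p_m z₀^m / P(z₀)`. -/
noncomputable def Tfun {V E : Type*} [Fintype V] [Fintype E] [DecidableEq V] [DecidableEq E]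
    (v1 v2 : E → V) (k : V → ℕ) (z0 : ℝ) (m : ℕ) : ℝ :=
  (m.factorial : ℝ) * (admCount v1 v2 k m : ℝ) * z0 ^ m / admPsum v1 v2 k z0


def Adm {V E : Type*} [Fintype E] [DecidableEq V]
    (v1 v2 : E → V) (k : V → ℕ) (M : Finset E) : Prop := ∀ v, degIn v1 v2 M v ≤ k v

section helpers
open scoped Classical in
/-- Edges that can be added to `M`. -/
noncomputable def addable {V E : Type*} [Fintype E] [DecidableEq V] [DecidableEq E]
    (v1 v2 : E → V) (k : V → ℕ) (M : Finset E) : Finset E :=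
  Finset.univ.filter (fun e => e ∉ M ∧ Adm v1 v2 k (insert e M))

/-- Admissible sets of size `m`. -/
def admSet {V E : Type*} [Fintype V] [Fintype E] [DecidableEq V] [DecidableEq E]
    (v1 v2 : E → V) (k : V → ℕ) (m : ℕ) : Finset (Finset E) :=
  Finset.univ.filter
    (fun M : Finset E => (∀ v, degIn v1 v2 M v ≤ k v) ∧ M.card = m)

variable {V E : Type*} [Fintype V] [Fintype E] [DecidableEq V] [DecidableEq E]
    (v1 v2 : E → V) (k : V → ℕ)

lemma degIn_insert (M : Finset E) (e : E) (he : e ∉ M) (v : V) :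
    degIn v1 v2 (insert e M) v = degIn v1 v2 M v + if v1 e = v ∨ v2 e = v then 1 else 0 := by
  unfold degIn
  rw [Finset.filter_insert]
  split_ifs with h
  · rw [Finset.card_insert_of_notMem]
    simp [he]
  · simp

lemma degIn_mono {M M' : Finset E} (h : M ⊆ M') (v : V) :
    degIn v1 v2 M v ≤ degIn v1 v2 M' v :=
  Finset.card_le_card (Finset.filter_subset_filter _ h)

lemma mem_addable (M : Finset E) (e : E) :
    e ∈ addable v1 v2 k M ↔ e ∉ M ∧ Adm v1 v2 k (insert e M) := by
  simp [addable]

lemma mem_admSet (m : ℕ) (M : Finset E) :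
    M ∈ admSet v1 v2 k m ↔ Adm v1 v2 k M ∧ M.card = m := by
  simp [admSet, Adm]

lemma double_count (m : ℕ) (f : Finset E → ℝ) :
    ∑ M ∈ admSet v1 v2 k m, ∑ e ∈ addable v1 v2 k M, f (insert e M)
      = (m + 1 : ℝ) * ∑ M ∈ admSet v1 v2 k (m + 1), f M := by
  have h : (m + 1 : ℝ) * ∑ M ∈ admSet v1 v2 k (m + 1), f M
      = ∑ M ∈ admSet v1 v2 k (m + 1), ∑ _e ∈ M, f M := by
    rw [Finset.mul_sum]
    refine Finset.sum_congr rfl fun M hM => ?_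
    rw [Finset.sum_const, ((mem_admSet v1 v2 k _ _).1 hM).2]
    simp
  rw [h, Finset.sum_sigma', Finset.sum_sigma']
  refine Finset.sum_bij' (fun x _ => ⟨insert x.2 x.1, x.2⟩) (fun x _ => ⟨x.1.erase x.2, x.2⟩)
    ?_ ?_ ?_ ?_ ?_
  · rintro ⟨M, e⟩ hx
    simp only [Finset.mem_sigma, mem_addable, mem_admSet] at hx ⊢
    obtain ⟨⟨h1, h2⟩, h3, h4⟩ := hx
    refine ⟨⟨h4, ?_⟩, Finset.mem_insert_self _ _⟩
    rw [Finset.card_insert_of_notMem h3, h2]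
  · rintro ⟨M, e⟩ hx
    simp only [Finset.mem_sigma, mem_addable, mem_admSet] at hx ⊢
    obtain ⟨⟨h1, h2⟩, h3⟩ := hx
    refine ⟨⟨fun v => (degIn_mono v1 v2 (Finset.erase_subset _ _) v).trans (h1 v), ?_⟩,
      Finset.notMem_erase _ _, ?_⟩
    · rw [Finset.card_erase_of_mem h3, h2]; rfl
    · rwa [Finset.insert_erase h3]
  · rintro ⟨M, e⟩ hx
    simp only [Finset.mem_sigma, mem_addable, mem_admSet] at hx
    simp [Finset.erase_insert hx.2.1]
  · rintro ⟨M, e⟩ hx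
    simp only [Finset.mem_sigma, mem_admSet] at hx
    simp [Finset.insert_erase hx.2]
  · rintro ⟨M, e⟩ hx
    rfl

lemma sum_addable (m : ℕ) :
    ∑ M ∈ admSet v1 v2 k m, ((addable v1 v2 k M).card : ℝ)
      = (m + 1 : ℝ) * (admCount v1 v2 k (m + 1) : ℝ) := by
  have := double_count v1 v2 k m (fun _ => 1)
  simpa [admCount, admSet] using this

/-- Edges blocked at `v` by the set `M`. -/
def blockedAt (M : Finset E) (v : V) : Finset E :=
  Finset.univ.filter (fun f => f ∉ M ∧ (v1 f = v ∨ v2 f = v) ∧ k v ≤ degIn v1 v2 M v)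

lemma card_blockedAt (M : Finset E) (v : V) :
    (blockedAt v1 v2 k M v).card
      ≤ Finset.univ.sup (fun v => degIn v1 v2 Finset.univ v - k v) := by
  refine le_trans ?_ (Finset.le_sup (f := fun v => degIn v1 v2 Finset.univ v - k v)
    (Finset.mem_univ v))
  by_cases h : k v ≤ degIn v1 v2 M v
  · have hd : Disjoint (blockedAt v1 v2 k M v) (M.filter (fun e => v1 e = v ∨ v2 e = v)) := by
      rw [Finset.disjoint_left]
      intro f hf hf'
      simp [blockedAt] at hf hf'
      exact hf.1 hf'.1
    have hc : (blockedAt v1 v2 k M v).card + degIn v1 v2 M v ≤ degIn v1 v2 Finset.univ v := by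
      unfold degIn
      rw [← Finset.card_union_of_disjoint hd]
      apply Finset.card_le_card
      intro f hf
      simp [blockedAt] at hf ⊢
      tauto
    show _ ≤ degIn v1 v2 Finset.univ v - k v
    omega
  · have : blockedAt v1 v2 k M v = ∅ := by
      simp [blockedAt, h]
    simp [this]

lemma addable_bound (M : Finset E) (e : E) (he : e ∈ addable v1 v2 k M) :
    (addable v1 v2 k M).card ≤ (addable v1 v2 k (insert e M)).card +
      (2 * Finset.univ.sup (fun v => degIn v1 v2 Finset.univ v - k v) + 1) := by
  have hsub : addable v1 v2 k M ⊆ addable v1 v2 k (insert e M) ∪ ({e} ∪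
      (blockedAt v1 v2 k (insert e M) (v1 e) ∪ blockedAt v1 v2 k (insert e M) (v2 e))) := by
    intro f hf
    by_cases hfe : f = e
    · simp [hfe]
    rw [mem_addable] at he hf
    have hfM : f ∉ insert e M := by simp [hfe, hf.1]
    by_cases hA : Adm v1 v2 k (insert f (insert e M))
    · exact Finset.mem_union_left _ ((mem_addable v1 v2 k _ _).2 ⟨hfM, hA⟩)
    · unfold Adm at hA
      push Not at hA
      obtain ⟨v, hv⟩ := hA
      have h1 := degIn_insert v1 v2 _ _ hfM v
      have h2 := degIn_insert v1 v2 _ _ he.1 v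
      have h3 := degIn_insert v1 v2 _ _ hf.1 v
      have h4 := he.2 v
      have h5 := hf.2 v
      have hfv : v1 f = v ∨ v2 f = v := by
        by_contra hc
        rw [if_neg hc] at h1
        omega
      rw [if_pos hfv] at h1 h3
      have hev : v1 e = v ∨ v2 e = v := by
        by_contra hc
        rw [if_neg hc] at h2
        omega
      have hb : f ∈ blockedAt v1 v2 k (insert e M) v := by
        unfold blockedAt
        rw [Finset.mem_filter]
        exact ⟨Finset.mem_univ _, hfM, hfv, by omega⟩
      rcases hev with h | h <;> subst h <;> simp [hb]
  have c0 := Finset.card_le_card hsub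
  have c1 := Finset.card_union_le (addable v1 v2 k (insert e M)) ({e} ∪
      (blockedAt v1 v2 k (insert e M) (v1 e) ∪ blockedAt v1 v2 k (insert e M) (v2 e)))
  have c2 := Finset.card_union_le {e}
      (blockedAt v1 v2 k (insert e M) (v1 e) ∪ blockedAt v1 v2 k (insert e M) (v2 e))
  have c3 := Finset.card_union_le
      (blockedAt v1 v2 k (insert e M) (v1 e)) (blockedAt v1 v2 k (insert e M) (v2 e))
  have c4 := card_blockedAt v1 v2 k (insert e M) (v1 e)
  have c5 := card_blockedAt v1 v2 k (insert e M) (v2 e)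
  rw [Finset.card_singleton] at c2
  omega

lemma admCount_pos (m : ℕ) (hm : m ≤ admMax v1 v2 k) : 0 < admCount v1 v2 k m := by
  have hne : (Finset.univ.filter
      (fun M : Finset E => ∀ v, degIn v1 v2 M v ≤ k v)).Nonempty :=
    ⟨∅, Finset.mem_filter.2 ⟨Finset.mem_univ _, fun v => by simp [degIn]⟩⟩
  obtain ⟨M, hM, hc⟩ := Finset.exists_mem_eq_sup _ hne Finset.card
  have hc' : m ≤ M.card := by
    rw [← hc]; exact hm
  obtain ⟨M', hs, hM'⟩ := Finset.exists_subset_card_eq hc'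
  apply Finset.card_pos.2
  refine ⟨M', ?_⟩
  simp only [Finset.mem_filter, Finset.mem_univ, true_and] at hM ⊢
  exact ⟨fun v => (degIn_mono v1 v2 hs v).trans (hM v), hM'⟩

lemma admPsum_pos (z0 : ℝ) (hz0 : 0 < z0) : 0 < admPsum v1 v2 k z0 := by
  apply Finset.sum_pos
  · intro m hm
    have := admCount_pos v1 v2 k m (by simp at hm; omega)
    positivity
  · simp

lemma key_ineq (m : ℕ) :
    ((m + 1 : ℝ) * admCount v1 v2 k (m + 1)) ^ 2 ≤ (admCount v1 v2 k m : ℝ) *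
      ((m + 1 : ℝ) * ((m + 2 : ℝ) * admCount v1 v2 k (m + 2)) +
      (2 * ((Finset.univ.sup (fun v => degIn v1 v2 Finset.univ v - k v) : ℕ) : ℝ) + 1) *
        ((m + 1 : ℝ) * admCount v1 v2 k (m + 1))) := by
  set c : ℝ :=
    2 * ((Finset.univ.sup (fun v => degIn v1 v2 Finset.univ v - k v) : ℕ) : ℝ) + 1 with hcdef
  have hcs := sq_sum_le_card_mul_sum_sq (s := admSet v1 v2 k m)
    (f := fun M => ((addable v1 v2 k M).card : ℝ))
  rw [sum_addable] at hcs
  refine hcs.trans ?_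
  have hp : ((admSet v1 v2 k m).card : ℝ) = admCount v1 v2 k m := rfl
  rw [hp]
  apply mul_le_mul_of_nonneg_left _ (Nat.cast_nonneg _)
  have h2 := double_count v1 v2 k m (fun M => ((addable v1 v2 k M).card : ℝ))
  rw [sum_addable] at h2
  have h3 : ((m + 1 : ℝ) * ((m + 2 : ℝ) * admCount v1 v2 k (m + 2)))
      = ∑ M ∈ admSet v1 v2 k m, ∑ e ∈ addable v1 v2 k M,
        ((addable v1 v2 k (insert e M)).card : ℝ) := by
    rw [h2]; push_cast; ring
  rw [h3, ← sum_addable, Finset.mul_sum, ← Finset.sum_add_distrib]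
  refine Finset.sum_le_sum fun M _ => ?_
  have h4 : ((addable v1 v2 k M).card : ℝ) ^ 2
      = ∑ e ∈ addable v1 v2 k M, ((addable v1 v2 k M).card : ℝ) := by
    simp [sq]
  have h5 : c * ((addable v1 v2 k M).card : ℝ) = ∑ e ∈ addable v1 v2 k M, c := by
    simp [mul_comm]
  rw [h4, h5, ← Finset.sum_add_distrib]
  refine Finset.sum_le_sum fun e he => ?_
  have := addable_bound v1 v2 k M e he
  rw [hcdef]
  exact_mod_cast this

lemma Tfun_ratio (z0 : ℝ) (hz0 : 0 < z0) (m : ℕ) (hm : m ≤ admMax v1 v2 k) :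
    Tfun v1 v2 k z0 (m + 1) / Tfun v1 v2 k z0 m
      = (m + 1 : ℝ) * admCount v1 v2 k (m + 1) / admCount v1 v2 k m * z0 := by
  have h1 := admPsum_pos v1 v2 k z0 hz0
  have h2 : (0 : ℝ) < admCount v1 v2 k m := by exact_mod_cast admCount_pos v1 v2 k m hm
  have h3 : (0 : ℝ) < m.factorial := by exact_mod_cast m.factorial_pos
  unfold Tfun
  rw [Nat.factorial_succ, pow_succ]
  push_cast
  field_simp

lemma Tfun_pos (z0 : ℝ) (hz0 : 0 < z0) (m : ℕ) (hm : m ≤ admMax v1 v2 k) :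
    0 < Tfun v1 v2 k z0 m := by
  have h1 := admPsum_pos v1 v2 k z0 hz0
  have h2 := admCount_pos v1 v2 k m hm
  unfold Tfun
  positivity

end helpers

/-- Verification of Ginibre's hypothesis for graph-counting polynomials with
`C(v) = {0,1,…,k_v}`: with `α = max_v (d_v − k_v)₊`, for `0 ≤ m ≤ N − 2` one has
`T_m > 0`, `T_{m+1} > 0`, and `T_{m+2}/T_{m+1} ≥ T_{m+1}/T_m − (2α+1) z₀`. -/
theorem ginibre_hypothesis_for_graph_counting {V E : Type*} [Fintype V] [Fintype E]
    [DecidableEq V] [DecidableEq E]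
    (v1 v2 : E → V) (hne : ∀ e, v1 e ≠ v2 e)
    (hdeg : ∀ v, 0 < degIn v1 v2 Finset.univ v)
    (k : V → ℕ) (hk : ∀ v, 1 ≤ k v)
    (z0 : ℝ) (hz0 : 0 < z0) :
    ∀ m : ℕ, m + 2 ≤ admMax v1 v2 k →
      0 < Tfun v1 v2 k z0 m ∧ 0 < Tfun v1 v2 k z0 (m + 1) ∧
      Tfun v1 v2 k z0 (m + 1) / Tfun v1 v2 k z0 m -
          (2 * ((Finset.univ.sup (fun v => degIn v1 v2 Finset.univ v - k v) : ℕ) : ℝ) + 1) * z0 ≤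
        Tfun v1 v2 k z0 (m + 2) / Tfun v1 v2 k z0 (m + 1) := by
  intro m hm
  refine ⟨Tfun_pos v1 v2 k z0 hz0 m (by omega), Tfun_pos v1 v2 k z0 hz0 (m + 1) (by omega), ?_⟩
  rw [Tfun_ratio v1 v2 k z0 hz0 m (by omega), Tfun_ratio v1 v2 k z0 hz0 (m + 1) (by omega)]
  have key := key_ineq v1 v2 k m
  set c : ℝ :=
    2 * ((Finset.univ.sup (fun v => degIn v1 v2 Finset.univ v - k v) : ℕ) : ℝ) + 1 with hcdef
  have p0 : (0 : ℝ) < admCount v1 v2 k m := by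
    exact_mod_cast admCount_pos v1 v2 k m (by omega)
  have p1 : (0 : ℝ) < admCount v1 v2 k (m + 1) := by
    exact_mod_cast admCount_pos v1 v2 k (m + 1) (by omega)
  rw [← sub_mul]
  apply mul_le_mul_of_nonneg_right _ hz0.le
  have hm1 : (0 : ℝ) < (m : ℝ) + 1 := by positivity
  push_cast
  rw [sub_le_iff_le_add, div_le_iff₀ p0, ← mul_le_mul_iff_right₀ (mul_pos hm1 p1)]
  calc _ = ((m + 1 : ℝ) * admCount v1 v2 k (m + 1)) ^ 2 := by ring
    _ ≤ _ := key
    _ = _ := by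
      field_simp
      ring
end
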